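/- For every finite joint probability space (𝒜×ℬ, μ) and every n ∈ ℕ with n ≥ 1, the maximal correlation tensorizes: ρ(𝒜^n, ℬ^n; μ^{⊗n}) = ρ(𝒜, ℬ; μ). -/

import Mathlib

open Finset MeasureTheory ProbabilityTheory Filter
open scoped Classical

noncomputable section

namespace NIS

/-- Expectation of `f` under the weight function `p` on a finite type. -/
def pmean {Ω : Type*} [Fintype Ω] (p : Ω → ℝ) (f : Ω → ℝ) : ℝ := ∑ ω, p ω * f ω

/-- Variance of `f` under the weight function `p` on a finite type. -/
def pvar {Ω : Type*} [Fintype Ω] (p : Ω → ℝ) (f : Ω → ℝ) : ℝ :=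
  pmean p (fun ω => (f ω - pmean p f) ^ 2)

/-- `p` is a probability distribution on the finite type `Ω`. -/
def IsDist {Ω : Type*} [Fintype Ω] (p : Ω → ℝ) : Prop :=
  (∀ ω, 0 ≤ p ω) ∧ ∑ ω, p ω = 1

/-- Probability of the event `E` under the weight function `p`. -/
def pprob {Ω : Type*} [Fintype Ω] (p : Ω → ℝ) (E : Ω → Prop) : ℝ :=
  ∑ ω, if E ω then p ω else 0

/-- Total variation distance between two distributions on a finite type. -/
def tvDist {Ω : Type*} [Fintype Ω] (p q : Ω → ℝ) : ℝ := (1 / 2) * ∑ ω, |p ω - q ω|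

/-- Marginal on the first coordinate of a joint distribution. -/
def marginalA {A B : Type*} [Fintype A] [Fintype B] (μ : A × B → ℝ) : A → ℝ :=
  fun a => ∑ b, μ (a, b)

/-- Marginal on the second coordinate of a joint distribution. -/
def marginalB {A B : Type*} [Fintype A] [Fintype B] (μ : A × B → ℝ) : B → ℝ :=
  fun b => ∑ a, μ (a, b)

/-- The Hirschfeld–Gebelein–Rényi maximal correlation of a finite joint distribution. -/
def maxCorr {A B : Type*} [Fintype A] [Fintype B] (μ : A × B → ℝ) : ℝ :=
  sSup { r | ∃ f : A → ℝ, ∃ g : B → ℝ,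
    pmean (marginalA μ) f = 0 ∧ pmean (marginalB μ) g = 0 ∧
    pvar (marginalA μ) f = 1 ∧ pvar (marginalB μ) g = 1 ∧
    pmean μ (fun ab => f ab.1 * g ab.2) = r }

/-- `n`-fold product distribution of a distribution `μA` on `A`. -/
def prodDist {A : Type*} [Fintype A] (μA : A → ℝ) (n : ℕ) : (Fin n → A) → ℝ :=
  fun x => ∏ i, μA (x i)

/-- `n`-fold product of a joint distribution `μ` on `A × B`, identified with a distribution on
`A^n × B^n`. -/
def prodPair {A B : Type*} [Fintype A] [Fintype B] (μ : A × B → ℝ) (n : ℕ) :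
    (Fin n → A) × (Fin n → B) → ℝ :=
  fun p => ∏ i, μ (p.1 i, p.2 i)

/-- The influence of coordinate `i` on `f : A^n → ℝ` with respect to `μA^{⊗n}`:
`Inf_i(f) = E_{x_{-i}}[Var_{x_i} f] = ½ E_{x, a}[(f(x) - f(x_i ← a))²]`. -/
def influence {A : Type*} [Fintype A] {n : ℕ} (μA : A → ℝ) (i : Fin n)
    (f : (Fin n → A) → ℝ) : ℝ :=
  (1 / 2) * ∑ x : Fin n → A, ∑ a : A,
    (∏ j, μA (x j)) * μA a * (f x - f (Function.update x i a)) ^ 2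

/-- Total influence of `f`. -/
def totalInfluence {A : Type*} [Fintype A] {n : ℕ} (μA : A → ℝ)
    (f : (Fin n → A) → ℝ) : ℝ :=
  ∑ i, influence μA i f

/-- `g` depends on at most `d` coordinates. -/
def DependsOnLE {A : Type*} {n : ℕ} (d : ℕ) (g : (Fin n → A) → ℝ) : Prop :=
  ∃ J : Finset (Fin n), J.card ≤ d ∧
    ∀ x y : Fin n → A, (∀ i ∈ J, x i = y i) → g x = g y

/-- `f` has degree at most `d`: it lies in the linear span of functions each depending on at
most `d` coordinates. -/
def degLE {A : Type*} {n : ℕ} (d : ℕ) (f : (Fin n → A) → ℝ) : Prop :=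
  f ∈ Submodule.span ℝ { g : (Fin n → A) → ℝ | DependsOnLE d g }

/-- Restriction of `P` fixing the coordinates in `H` to the values of `ξ`; the result only
depends on the coordinates outside `H`. -/
def restrictFn {A : Type*} {n : ℕ} (H : Finset (Fin n)) (ξ : Fin n → A)
    (P : (Fin n → A) → ℝ) : (Fin n → A) → ℝ :=
  fun x => P (fun i => if i ∈ H then ξ i else x i)

/-- The 2-dimensional Gaussian distribution `G(ρ)` with standard normal marginals and
correlation `ρ`. -/
def gauss2 (ρ : ℝ) : Measure (ℝ × ℝ) :=
  Measure.map (fun p : ℝ × ℝ => (p.1, ρ * p.1 + Real.sqrt (1 - ρ ^ 2) * p.2))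
    ((gaussianReal 0 1).prod (gaussianReal 0 1))

/-- The standard normal cumulative distribution function `Φ`. -/
def stdNormalCDF (t : ℝ) : ℝ := ((gaussianReal 0 1) (Set.Iic t)).toReal

/-- The inverse `Φ⁻¹` of the standard normal CDF (junk values outside `(0,1)`). -/
def stdNormalCDFInv : ℝ → ℝ := Function.invFun stdNormalCDF

/-- The ±1-valued threshold function: `thr t r = 1` if `r ≥ t`, and `-1` otherwise. -/
def thr (t r : ℝ) : ℝ := if t ≤ r then 1 else -1

/-- The Gaussian stability quantity `Γ̄_ρ(m, v)`. -/
def Gammabar (ρ m v : ℝ) : ℝ :=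
  ∫ q : ℝ × ℝ, (if q.1 ≤ stdNormalCDFInv ((1 + m) / 2) then (1 : ℝ) else -1) *
    (if q.2 ≤ stdNormalCDFInv ((1 + v) / 2) then (1 : ℝ) else -1) ∂(gauss2 ρ)

/-- Pushforward of `μ^{⊗n}` under the pair of maps `(f, g)`. -/
def push {A B U V : Type*} [Fintype A] [Fintype B] (μ : A × B → ℝ) (n : ℕ)
    (f : (Fin n → A) → U) (g : (Fin n → B) → V) : U × V → ℝ :=
  fun uv => ∑ z : Fin n → A × B,
    if f (fun i => (z i).1) = uv.1 ∧ g (fun i => (z i).2) = uv.2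
    then ∏ i, μ (z i) else 0

/-- `ν` can be non-interactively simulated from `μ`. -/
def CanSimulate {A B U V : Type*} [Fintype A] [Fintype B] [Fintype U] [Fintype V]
    (μ : A × B → ℝ) (ν : U × V → ℝ) : Prop :=
  ∃ f : (n : ℕ) → (Fin n → A) → U, ∃ g : (n : ℕ) → (Fin n → B) → V,
    Tendsto (fun n => tvDist (push μ n (f n) (g n)) ν) atTop (nhds 0)

/-- The doubly symmetric binary source `DSBS(ρ)`, as a distribution on `Bool × Bool`, where
`true` encodes `+1` and `false` encodes `-1`. -/
def DSBS (ρ : ℝ) : Bool × Bool → ℝ :=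
  fun bv => if bv.1 = bv.2 then (1 + ρ) / 4 else (1 - ρ) / 4

/-- The ±1 value encoded by a Boolean. -/
def sgn (b : Bool) : ℝ := if b then 1 else -1

/-- Minimum nonzero probability of an atom. -/
def minAtom {A : Type*} [Fintype A] (μA : A → ℝ) : ℝ :=
  sInf { x | ∃ a, μA a = x ∧ 0 < x }

/-- The hypercontractivity constant `C₄(α)`. -/
def C4 (α : ℝ) : ℝ :=
  if α = 1 / 2 then 3 else
    (((1 - α) / α) ^ ((3 : ℝ) / 4) - ((1 - α) / α) ^ (-((3 : ℝ) / 4))) /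
    (((1 - α) / α) ^ ((1 : ℝ) / 4) - ((1 - α) / α) ^ (-((1 : ℝ) / 4)))

section Mean

variable {Ω : Type*} [Fintype Ω] (p f g : Ω → ℝ)

lemma pmean_add : pmean p (fun ω => f ω + g ω) = pmean p f + pmean p g := by
  simp only [pmean, mul_add, sum_add_distrib]

lemma pmean_sub : pmean p (fun ω => f ω - g ω) = pmean p f - pmean p g := by
  simp only [pmean, mul_sub, sum_sub_distrib]

lemma pmean_const_mul (c : ℝ) : pmean p (fun ω => c * f ω) = c * pmean p f := by
  simp only [pmean, mul_sum]
  exact sum_congr rfl fun _ _ => by ring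

lemma pmean_mul_const (c : ℝ) : pmean p (fun ω => f ω * c) = pmean p f * c := by
  simp only [mul_comm _ c, pmean_const_mul]

variable {p f g}

lemma IsDist.pmean_const (hp : IsDist p) (c : ℝ) : pmean p (fun _ => c) = c := by
  simp only [pmean, ← sum_mul, hp.2, one_mul]

lemma IsDist.pmean_mono (hp : IsDist p) (h : ∀ ω, f ω ≤ g ω) : pmean p f ≤ pmean p g :=
  sum_le_sum fun ω _ => mul_le_mul_of_nonneg_left (h ω) (hp.1 ω)

lemma IsDist.pmean_nonneg (hp : IsDist p) (h : ∀ ω, 0 ≤ f ω) : 0 ≤ pmean p f :=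
  sum_nonneg fun ω _ => mul_nonneg (hp.1 ω) (h ω)

/-- Cauchy–Schwarz for weighted means. -/
lemma IsDist.sq_pmean_mul_le (hp : IsDist p) :
    pmean p (fun ω => f ω * g ω) ^ 2 ≤
      pmean p (fun ω => f ω ^ 2) * pmean p (fun ω => g ω ^ 2) := by
  have key : ∀ t : ℝ, 0 ≤ pmean p (fun ω => f ω ^ 2) * (t * t) +
      (-2 * pmean p (fun ω => f ω * g ω)) * t + pmean p (fun ω => g ω ^ 2) := by
    intro t
    have h : 0 ≤ pmean p (fun ω => (t * f ω - g ω) ^ 2) := hp.pmean_nonneg fun ω => sq_nonneg _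
    have e : (fun ω => (t * f ω - g ω) ^ 2) =
        fun ω => ((t * t) * f ω ^ 2 - (2 * t) * (f ω * g ω)) + g ω ^ 2 := by
      ext ω; ring
    rw [e, pmean_add, pmean_sub, pmean_const_mul, pmean_const_mul] at h
    linarith
  have := discrim_le_zero key
  rw [discrim] at this
  linarith

lemma pvar_eq_of_pmean_eq_zero (h : pmean p f = 0) : pvar p f = pmean p (fun ω => f ω ^ 2) := by
  simp only [pvar, h, sub_zero]

end Mean

section MaximalCorrelation

variable {A B : Type*} [Fintype A] [Fintype B] {μ : A × B → ℝ}

lemma pmean_marginalA (f : A → ℝ) : pmean (marginalA μ) f = pmean μ (fun ab => f ab.1) := by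
  simp only [pmean, marginalA, Fintype.sum_prod_type, sum_mul]

lemma pmean_marginalB (g : B → ℝ) : pmean (marginalB μ) g = pmean μ (fun ab => g ab.2) := by
  simp only [pmean, marginalB, Fintype.sum_prod_type_right, sum_mul]

variable (μ) in
/-- The set of correlations of normalized pairs of functions. -/
def correlations : Set ℝ :=
  { r | ∃ f : A → ℝ, ∃ g : B → ℝ,
    pmean μ (fun ab => f ab.1) = 0 ∧ pmean μ (fun ab => g ab.2) = 0 ∧
    pmean μ (fun ab => f ab.1 ^ 2) = 1 ∧ pmean μ (fun ab => g ab.2 ^ 2) = 1 ∧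
    pmean μ (fun ab => f ab.1 * g ab.2) = r }

variable (μ) in
lemma maxCorr_eq_sSup_correlations : maxCorr μ = sSup (correlations μ) := by
  unfold maxCorr correlations
  congr 1
  ext r
  refine exists_congr fun f => exists_congr fun g => ?_
  rw [← pmean_marginalA f, ← pmean_marginalB g, ← pmean_marginalA (fun a => f a ^ 2),
    ← pmean_marginalB (fun b => g b ^ 2)]
  refine and_congr_right fun hf => and_congr_right fun hg => ?_
  rw [pvar_eq_of_pmean_eq_zero hf, pvar_eq_of_pmean_eq_zero hg]

variable (μ) in
/-- The covariance of `f` and `g` is at most `r` times the average of their variances. -/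
def CovarianceBound (r : ℝ) : Prop :=
  ∀ (f : A → ℝ) (g : B → ℝ),
    2 * (pmean μ (fun ab => f ab.1 * g ab.2)
      - pmean μ (fun ab => f ab.1) * pmean μ (fun ab => g ab.2)) ≤
    r * ((pmean μ (fun ab => f ab.1 ^ 2) - pmean μ (fun ab => f ab.1) ^ 2) +
      (pmean μ (fun ab => g ab.2 ^ 2) - pmean μ (fun ab => g ab.2) ^ 2))

lemma CovarianceBound.maxCorr_le {r : ℝ} (h : CovarianceBound μ r) (hr : 0 ≤ r) :
    maxCorr μ ≤ r := by
  rw [maxCorr_eq_sSup_correlations]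
  refine Real.sSup_le ?_ hr
  rintro _ ⟨f, g, hf, hg, hf2, hg2, rfl⟩
  have := h f g
  rw [hf, hg, hf2, hg2] at this
  linarith

lemma IsDist.bddAbove_correlations (hμ : IsDist μ) : BddAbove (correlations μ) := by
  refine ⟨1, ?_⟩
  rintro _ ⟨f, g, -, -, hf2, hg2, rfl⟩
  have h := hμ.sq_pmean_mul_le (f := fun ab => f ab.1) (g := fun ab => g ab.2)
  rw [hf2, hg2] at h
  nlinarith

lemma IsDist.maxCorr_nonneg (hμ : IsDist μ) : 0 ≤ maxCorr μ := by
  rw [maxCorr_eq_sSup_correlations]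
  rcases (correlations μ).eq_empty_or_nonempty with h | ⟨r, hr⟩
  · rw [h, Real.sSup_empty]
  · have h1 := le_csSup hμ.bddAbove_correlations hr
    have h2 : -r ∈ correlations μ := by
      obtain ⟨f, g, hf, hg, hf2, hg2, rfl⟩ := hr
      refine ⟨fun a => -1 * f a, g, ?_, hg, ?_, hg2, ?_⟩
      · rw [pmean_const_mul, hf, mul_zero]
      · simpa [mul_pow] using hf2
      · simp only [mul_assoc, pmean_const_mul]
        ring
    have h3 := le_csSup hμ.bddAbove_correlations h2
    linarith

lemma IsDist.two_mul_pmean_mul_le (hμ : IsDist μ) {f : A → ℝ} {g : B → ℝ}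
    (hf : pmean μ (fun ab => f ab.1) = 0) (hg : pmean μ (fun ab => g ab.2) = 0) :
    2 * pmean μ (fun ab => f ab.1 * g ab.2) ≤
      maxCorr μ * (pmean μ (fun ab => f ab.1 ^ 2) + pmean μ (fun ab => g ab.2 ^ 2)) := by
  have hCS := hμ.sq_pmean_mul_le (f := fun ab => f ab.1) (g := fun ab => g ab.2)
  have hf2 : 0 ≤ pmean μ (fun ab => f ab.1 ^ 2) := hμ.pmean_nonneg fun _ => sq_nonneg _
  have hg2 : 0 ≤ pmean μ (fun ab => g ab.2 ^ 2) := hμ.pmean_nonneg fun _ => sq_nonneg _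
  have hρ := hμ.maxCorr_nonneg
  set V := pmean μ (fun ab => f ab.1 ^ 2) with hV
  set W := pmean μ (fun ab => g ab.2 ^ 2) with hW
  set C := pmean μ (fun ab => f ab.1 * g ab.2) with hC
  by_cases h0 : V * W = 0
  · have : C = 0 := by
      rw [h0] at hCS
      exact pow_eq_zero_iff two_ne_zero |>.1 (le_antisymm hCS (sq_nonneg C))
    rw [this, mul_zero]
    positivity
  have hV0 : 0 < V := lt_of_le_of_ne hf2 fun h => h0 (by rw [← h, zero_mul])
  have hW0 : 0 < W := lt_of_le_of_ne hg2 fun h => h0 (by rw [← h, mul_zero])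
  have hs := Real.sqrt_pos.2 hV0
  have ht := Real.sqrt_pos.2 hW0
  have hs2 := Real.sq_sqrt hV0.le
  have ht2 := Real.sq_sqrt hW0.le
  set s := √V
  set t := √W
  have hmem : s⁻¹ * t⁻¹ * C ∈ correlations μ := by
    refine ⟨fun a => s⁻¹ * f a, fun b => t⁻¹ * g b, ?_, ?_, ?_, ?_, ?_⟩
    · rw [pmean_const_mul, hf, mul_zero]
    · rw [pmean_const_mul, hg, mul_zero]
    · simp only [mul_pow, pmean_const_mul]
      rw [← hV, ← hs2]
      field_simp
    · simp only [mul_pow, pmean_const_mul]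
      rw [← hW, ← ht2]
      field_simp
    · rw [hC, ← pmean_const_mul]
      congr 1
      ext ab
      ring
  have hle : s⁻¹ * t⁻¹ * C ≤ maxCorr μ := by
    rw [maxCorr_eq_sSup_correlations]
    exact le_csSup hμ.bddAbove_correlations hmem
  have hC' : C ≤ maxCorr μ * (s * t) := by
    calc C = s⁻¹ * t⁻¹ * C * (s * t) := by field_simp
      _ ≤ _ := mul_le_mul_of_nonneg_right hle (by positivity)
  have hst : 2 * (s * t) ≤ V + W := by nlinarith [sq_nonneg (s - t)]
  nlinarith [mul_le_mul_of_nonneg_left hst hρ]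

lemma IsDist.covarianceBound_maxCorr (hμ : IsDist μ) : CovarianceBound μ (maxCorr μ) := by
  intro f g
  set m := pmean μ (fun ab => f ab.1) with hm
  set k := pmean μ (fun ab => g ab.2) with hk
  have h := hμ.two_mul_pmean_mul_le (f := fun a => f a - m) (g := fun b => g b - k)
    (by rw [pmean_sub, hμ.pmean_const, ← hm, sub_self])
    (by rw [pmean_sub, hμ.pmean_const, ← hk, sub_self])
  have e1 : pmean μ (fun ab => (f ab.1 - m) * (g ab.2 - k)) =
      pmean μ (fun ab => f ab.1 * g ab.2) - m * k := by
    have : (fun ab : A × B => (f ab.1 - m) * (g ab.2 - k)) =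
        fun ab => ((f ab.1 * g ab.2 - m * g ab.2) - k * f ab.1) + m * k := by
      ext ab; ring
    rw [this, pmean_add, pmean_sub, pmean_sub, pmean_const_mul, pmean_const_mul, hμ.pmean_const]
    linarith
  have e2 : pmean μ (fun ab => (f ab.1 - m) ^ 2) = pmean μ (fun ab => f ab.1 ^ 2) - m ^ 2 := by
    have : (fun ab : A × B => (f ab.1 - m) ^ 2) =
        fun ab => (f ab.1 ^ 2 - (2 * m) * f ab.1) + m ^ 2 := by
      ext ab; ring
    rw [this, pmean_add, pmean_sub, pmean_const_mul, hμ.pmean_const]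
    linarith
  have e3 : pmean μ (fun ab => (g ab.2 - k) ^ 2) = pmean μ (fun ab => g ab.2 ^ 2) - k ^ 2 := by
    have : (fun ab : A × B => (g ab.2 - k) ^ 2) =
        fun ab => (g ab.2 ^ 2 - (2 * k) * g ab.2) + k ^ 2 := by
      ext ab; ring
    rw [this, pmean_add, pmean_sub, pmean_const_mul, hμ.pmean_const]
    linarith
  rwa [e1, e2, e3] at h

end MaximalCorrelation

section Product

variable {A B : Type*} [Fintype A] [Fintype B] {μ : A × B → ℝ}

variable (μ) in
lemma pmean_prodPair_succ (n : ℕ) (h : (Fin (n + 1) → A) × (Fin (n + 1) → B) → ℝ) :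
    pmean (prodPair μ (n + 1)) h = pmean μ (fun ab =>
      pmean (prodPair μ n) (fun xy => h (Fin.cons ab.1 xy.1, Fin.cons ab.2 xy.2))) := by
  simp only [pmean, mul_sum]
  rw [← Fintype.sum_prod_type']
  symm
  refine Fintype.sum_equiv ((Equiv.prodProdProdComm A B (Fin n → A) (Fin n → B)).trans
    ((Fin.consEquiv fun _ => A).prodCongr (Fin.consEquiv fun _ => B))) _ _ ?_
  rintro ⟨⟨a, b⟩, x, y⟩
  simp [prodPair, Fin.prod_univ_succ, Fin.consEquiv, mul_assoc]

lemma IsDist.prodPair (hμ : IsDist μ) (n : ℕ) : IsDist (prodPair μ n) := by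
  refine ⟨fun p => prod_nonneg fun i _ => hμ.1 _, ?_⟩
  suffices pmean (NIS.prodPair μ n) (fun _ => 1) = 1 by simpa [pmean] using this
  induction n with
  | zero => simp [pmean, NIS.prodPair]
  | succ n ih => rw [pmean_prodPair_succ, ih, hμ.pmean_const]

lemma CovarianceBound.prodPair (hμ : IsDist μ) {r : ℝ} (h : CovarianceBound μ r) (n : ℕ) :
    CovarianceBound (prodPair μ n) r := by
  induction n with
  | zero =>
    intro f g
    simp [pmean, NIS.prodPair, Fintype.sum_prod_type]
  | succ n ih =>
    intro f g
    simp only [pmean_prodPair_succ]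
    set u : A → ℝ := fun a => pmean (NIS.prodPair μ n) (fun xy => f (Fin.cons a xy.1)) with hu
    set v : B → ℝ := fun b => pmean (NIS.prodPair μ n) (fun xy => g (Fin.cons b xy.2)) with hv
    have outer := h u v
    have inner := hμ.pmean_mono fun ab : A × B =>
      ih (fun x => f (Fin.cons ab.1 x)) (fun y => g (Fin.cons ab.2 y))
    simp only [pmean_const_mul, pmean_sub, pmean_add] at inner
    simp only [hu, hv] at outer
    linarith

lemma CovarianceBound.of_prodPair_succ (hμ : IsDist μ) {r : ℝ} {n : ℕ}
    (h : CovarianceBound (NIS.prodPair μ (n + 1)) r) : CovarianceBound μ r := by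
  intro f g
  have := h (fun x => f (x 0)) (fun y => g (y 0))
  simpa only [pmean_prodPair_succ, Fin.cons_zero, (hμ.prodPair n).pmean_const] using this

end Product

/-- Tensorization of maximal correlation:
`ρ(𝒜^n, ℬ^n; μ^{⊗n}) = ρ(𝒜, ℬ; μ)` for every `n ≥ 1`. -/
theorem stmt16 {A B : Type*} [Fintype A] [Fintype B] (μ : A × B → ℝ) (hμ : IsDist μ)
    (n : ℕ) (hn : 1 ≤ n) : maxCorr (prodPair μ n) = maxCorr μ := by
  obtain ⟨m, rfl⟩ := Nat.exists_eq_add_of_le' hn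
  have hν := hμ.prodPair (m + 1)
  exact le_antisymm
    ((hμ.covarianceBound_maxCorr.prodPair hμ (m + 1)).maxCorr_le hμ.maxCorr_nonneg)
    ((hν.covarianceBound_maxCorr.of_prodPair_succ hμ).maxCorr_le hν.maxCorr_nonneg)

end NIS
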